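/- arXiv:2604.21597 — 2 statements merged into one kernel-verified Lean document; each statement's English description precedes it below -/
import Mathlib

section
/- Let 𝕜 be a perfect field of characteristic p > 0 and let A be a finitely generated 𝕜-algebra that is an integral domain of Krull dimension d. Then the field extension Frac(A) over Frac(A)^p (equivalently, over the field of fractions of the subring A^p of p-th powers) has degree exactly p^d. -/
open MvPolynomial in
lemma coeff_pow_p {k : Type*} [Field k] (p : ℕ) [hp : Fact p.Prime] [CharP k p] {d : ℕ}
    (f : MvPolynomial (Fin d) k) (m : Fin d →₀ ℕ) (a b : Fin d → Fin p) :
    coeff (p • m + Finsupp.equivFunOnFinite.symm (fun i => (a i : ℕ)))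
      (f ^ p * monomial (Finsupp.equivFunOnFinite.symm (fun i => (b i : ℕ))) 1)
      = if b = a then (coeff m f) ^ p else 0 := by
  rw [← map_frobenius_expand p, coeff_mul_monomial']
  split_ifs with h1 h2 h2
  · subst h2
    rw [add_tsub_cancel_right, coeff_map, coeff_expand_smul p hp.out.ne_zero]
    simp [frobenius_def]
  · obtain ⟨i, hi⟩ := Function.ne_iff.mp h2
    rw [coeff_map, coeff_expand_of_not_dvd (i := i), map_zero, zero_mul]
    have h3 := h1 i
    simp only [Finsupp.coe_tsub, Finsupp.coe_add, Finsupp.coe_smul, Pi.sub_apply, Pi.add_apply,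
      Pi.smul_apply, smul_eq_mul, Finsupp.equivFunOnFinite_symm_apply_apply] at h3 ⊢
    intro h4
    apply hi
    have h5 := (Nat.modEq_iff_dvd' h3).mpr h4
    rw [Nat.ModEq, Nat.mul_add_mod, Nat.mod_eq_of_lt (b i).2, Nat.mod_eq_of_lt (a i).2] at h5
    exact Fin.ext h5
  · subst h2
    exact absurd (le_add_self) h1
  · rfl

/-- A copy of `R`, regarded as an `R`-algebra through Frobenius. -/
def Frb (R : Type*) (_p : ℕ) : Type _ := R

noncomputable instance {R : Type*} [h : CommRing R] (p : ℕ) : CommRing (Frb R p) := h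

instance {R : Type*} [CommRing R] [h : IsDomain R] (p : ℕ) : IsDomain (Frb R p) := h

noncomputable instance {R : Type*} [CommRing R] (p : ℕ) [Fact p.Prime] [CharP R p] :
    Algebra R (Frb R p) := RingHom.toAlgebra (S := Frb R p) (frobenius R p)

lemma Frb.smul_def {R : Type*} [CommRing R] (p : ℕ) [Fact p.Prime] [CharP R p] (x : R)
    (y : Frb R p) : x • y = (show Frb R p from x ^ p) * y := rfl

lemma Frb.linearIndependent {R : Type*} [CommRing R] (p : ℕ) [Fact p.Prime] [CharP R p]
    {ι : Type*} [Fintype ι] (v : ι → Frb R p)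
    (h : ∀ g : ι → R, ∑ i, g i • v i = 0 → ∀ i, g i = 0) : LinearIndependent R v :=
  Fintype.linearIndependent_iff.mpr h

open MvPolynomial in
lemma finrank_frb_mvPolynomial {k : Type*} [Field k] [PerfectField k] (p : ℕ) [hp : Fact p.Prime]
    [CharP k p] (d : ℕ) :
    Module.finrank (MvPolynomial (Fin d) k) (Frb (MvPolynomial (Fin d) k) p) = p ^ d := by
  have : PerfectRing k p := PerfectField.toPerfectRing p
  let v : (Fin d → Fin p) → Frb (MvPolynomial (Fin d) k) p := fun b =>
    (monomial (Finsupp.equivFunOnFinite.symm (fun i => (b i : ℕ))) 1 : MvPolynomial (Fin d) k)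
  have hli : LinearIndependent (MvPolynomial (Fin d) k) v := by
    refine Frb.linearIndependent p v fun g hg a => ?_
    ext m
    have h1 : (∑ b, (g b ^ p * monomial (Finsupp.equivFunOnFinite.symm (fun i => (b i : ℕ))) 1) :
      MvPolynomial (Fin d) k) = 0 := hg
    have h2 := congrArg
      (coeff (p • m + Finsupp.equivFunOnFinite.symm (fun i => (a i : ℕ)))) h1
    rw [coeff_sum] at h2
    simp only [coeff_pow_p] at h2
    simpa [hp.out.ne_zero] using h2
  have hsp : ⊤ ≤ Submodule.span (MvPolynomial (Fin d) k) (Set.range v) := by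
    rintro (x : MvPolynomial (Fin d) k) -
    induction x using MvPolynomial.induction_on' with
    | monomial u c =>
      obtain ⟨c', rfl⟩ := (frobeniusEquiv k p).surjective c
      let b : Fin d → Fin p := fun i => ⟨u i % p, Nat.mod_lt _ hp.out.pos⟩
      have : (monomial u (frobeniusEquiv k p c') : MvPolynomial (Fin d) k) =
          (monomial (Finsupp.equivFunOnFinite.symm (fun i => u i / p)) c') ^ p *
          monomial (Finsupp.equivFunOnFinite.symm (fun i => (b i : ℕ))) 1 := by
        rw [monomial_pow, monomial_mul]
        congr 2
        · ext i
          simp [b, Nat.div_add_mod]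
        · simp [frobenius_def]
      have h3 := Submodule.smul_mem _
        (monomial (Finsupp.equivFunOnFinite.symm (fun i => u i / p)) c')
        (Submodule.subset_span (R := MvPolynomial (Fin d) k) (Set.mem_range_self (f := v) b))
      rw [Frb.smul_def] at h3
      rw [this]
      exact h3
    | add f g hf hg => exact Submodule.add_mem _ hf hg
  rw [Module.finrank_eq_card_basis (Module.Basis.mk hli hsp)]
  simp

/-- Frobenius degree is insensitive to finite extensions of domains. -/
lemma finrank_frb_eq (R S : Type*) [CommRing R] [IsDomain R] [CommRing S] [IsDomain S]
    [Algebra R S] [FaithfulSMul R S] (h0 : Module.finrank R S ≠ 0)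
    (p : ℕ) [hp : Fact p.Prime] [CharP R p] [CharP S p] :
    Module.finrank S (Frb S p) = Module.finrank R (Frb R p) := by
  let : Algebra (Frb R p) (Frb S p) := inferInstanceAs (Algebra R S)
  let : Algebra R (Frb S p) := ((algebraMap S (Frb S p)).comp (algebraMap R S)).toAlgebra
  have : IsScalarTower R S (Frb S p) := IsScalarTower.of_algebraMap_eq fun _ => rfl
  have : IsScalarTower R (Frb R p) (Frb S p) := IsScalarTower.of_algebraMap_eq fun x =>
    ((algebraMap R S).map_pow x p).symm
  have : FaithfulSMul (Frb R p) (Frb S p) := inferInstanceAs (FaithfulSMul R S)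
  have : FaithfulSMul S (Frb S p) := (faithfulSMul_iff_algebraMap_injective _ _).2
    (frobenius_inj S p)
  have h1 := Module.finrank_mul_finrank' (R := R) (S := S) (Frb S p)
  have h2 := Module.finrank_mul_finrank' (R := R) (S := Frb R p) (Frb S p)
  have h3 : Module.finrank (Frb R p) (Frb S p) = Module.finrank R S := rfl
  rw [h3, ← h1, mul_comm] at h2
  exact (mul_left_cancel₀ h0 h2).symm

lemma finrank_frb_frac (R : Type*) [CommRing R] [IsDomain R]
    (p : ℕ) [hp : Fact p.Prime] [CharP R p] [CharP (FractionRing R) p] :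
    Module.finrank (FractionRing R) (Frb (FractionRing R) p) = Module.finrank R (Frb R p) := by
  apply finrank_frb_eq
  rw [IsFractionRing.finrank_left_eq R R (FractionRing R) |>.symm]
  simp

lemma ringKrullDim_eq_of_integral (R S : Type*) [CommRing R] [CommRing S] [IsDomain S]
    [Algebra R S] [FaithfulSMul R S] [Algebra.IsIntegral R S] :
    ringKrullDim S = ringKrullDim R := by
  apply le_antisymm
  · exact Order.krullDim_le_of_strictMono (PrimeSpectrum.comap (algebraMap R S))
      fun I J h => Ideal.IsIntegral.comap_lt_comap (R := R) (I := I.asIdeal) (J := J.asIdeal) h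
  · refine iSup_le fun l => ?_
    obtain ⟨Q, hQ, hQ'⟩ := Ideal.exists_ideal_over_prime_of_isIntegral_of_isDomain
      (R := R) (S := S) l.head.asIdeal
      (by rw [(RingHom.injective_iff_ker_eq_bot _).1 (FaithfulSMul.algebraMap_injective R S)]
          exact bot_le)
    have : Q.LiesOver l.head.asIdeal := ⟨hQ'.symm⟩
    obtain ⟨L, hL, -⟩ := Ideal.exists_ltSeries_of_hasGoingUp l Q
    rw [← hL]
    exact le_iSup (fun l : LTSeries (PrimeSpectrum S) => ((l.length : ℕ) : WithBot ℕ∞)) L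


/-- Let `𝕜` be a perfect field of characteristic `p > 0` and `A` a finitely generated
`𝕜`-algebra which is an integral domain of Krull dimension `d`.  Then the degree of
`Frac(A)` over its subfield of `p`-th powers (the field of fractions of `A^p`) is exactly
`p^d`. -/
theorem stmt9 {𝕜 A : Type*} [Field 𝕜] [PerfectField 𝕜] (p : ℕ) [Fact p.Prime] [CharP 𝕜 p]
    [CommRing A] [IsDomain A] [Algebra 𝕜 A] [Algebra.FiniteType 𝕜 A]
    (d : ℕ) (hd : ringKrullDim A = d) :
    ∀ F : Subfield (FractionRing A),
      F = Subfield.closure (Set.range fun x : FractionRing A => x ^ p) →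
      Module.finrank F (FractionRing A) = p ^ d := by
  rintro F rfl
  obtain ⟨s, g, hg, hfin⟩ := exists_finite_inj_algHom_of_fg 𝕜 A
  let : Algebra (MvPolynomial (Fin s) 𝕜) A := g.toRingHom.toAlgebra
  have : Module.Finite (MvPolynomial (Fin s) 𝕜) A := hfin
  have : FaithfulSMul (MvPolynomial (Fin s) 𝕜) A :=
    (faithfulSMul_iff_algebraMap_injective _ _).2 hg
  have hs : s = d := by
    have h1 := ringKrullDim_eq_of_integral (MvPolynomial (Fin s) 𝕜) A
    rw [hd, MvPolynomial.ringKrullDim_of_isNoetherianRing, ringKrullDim_eq_zero_of_field] at h1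
    simp only [Nat.card_eq_fintype_card, Fintype.card_fin, zero_add] at h1
    exact_mod_cast h1.symm
  subst hs
  have : CharP A p := charP_of_injective_algebraMap (algebraMap 𝕜 A).injective p
  have : CharP (FractionRing A) p :=
    charP_of_injective_algebraMap (IsFractionRing.injective A (FractionRing A)) p
  have h0 : Module.finrank (MvPolynomial (Fin s) 𝕜) A ≠ 0 := Module.finrank_pos.ne'
  have hmain : Module.finrank (FractionRing A) (Frb (FractionRing A) p) = p ^ s := by
    rw [finrank_frb_frac, finrank_frb_eq (MvPolynomial (Fin s) 𝕜) A h0,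
      finrank_frb_mvPolynomial]
  rw [← hmain]
  have hF : Subfield.closure (Set.range fun x : FractionRing A => x ^ p) =
      (frobenius (FractionRing A) p).fieldRange := by
    rw [← Subfield.closure_eq (frobenius (FractionRing A) p).fieldRange, RingHom.coe_fieldRange]
    rfl
  rw [hF]
  exact (Algebra.finrank_eq_of_equiv_equiv (S₀ := Frb (FractionRing A) p)
    (frobenius (FractionRing A) p).rangeRestrictFieldEquiv
    (RingEquiv.refl (FractionRing A)) (by ext; rfl)).symm
end

section
/- Let R be an integral domain, and let M, M' be finitely generated R-modules with M ⊆ M' such that M' / M is a torsion R-module. Then M and M' have the same rank, where rank(M) := dim_{Frac(R)} (Frac(R) ⊗_R M). More specifically: if 𝒜 is a filtered algebra over a field with exhaustive, separated, discrete filtration, 𝒵 ⊆ 𝒜 a filtered central subalgebra such that gr 𝒵 is an integral domain and gr 𝒜 is a finitely generated gr 𝒵-module of rank r, then 𝒵 is an integral domain and 𝒜 is a finitely generated 𝒵-module of rank r. -/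
open TensorProduct

universe u v

/-- Rank is unchanged when passing to a submodule with torsion quotient. -/
theorem rank_eq_of_torsion {R M : Type*} [CommRing R] [IsDomain R] [AddCommGroup M] [Module R M]
    (L : Submodule R M) (h : ∀ x : M, ∃ r : R, r ≠ 0 ∧ r • x ∈ L) :
    Module.rank R L = Module.rank R M := by
  rw [← rank_quotient_add_rank_of_isDomain L]
  have : Module.rank R (M ⧸ L) = 0 := by
    rw [rank_eq_zero_iff]
    intro x
    obtain ⟨x, rfl⟩ := Submodule.Quotient.mk_surjective _ x
    obtain ⟨r, hr, hx⟩ := h x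
    refine ⟨r, hr, ?_⟩
    rw [← Submodule.Quotient.mk_smul]
    exact (Submodule.Quotient.mk_eq_zero _).2 hx
  rw [this, zero_add]

/-- If the generators are torsion modulo `L`, so is everything. -/
theorem torsion_of_gen {R M ι : Type*} [CommRing R] [IsDomain R] [AddCommGroup M] [Module R M]
    (L : Submodule R M) (v : ι → M) (hv : Submodule.span R (Set.range v) = ⊤)
    (h : ∀ i, ∃ r : R, r ≠ 0 ∧ r • v i ∈ L) (x : M) : ∃ r : R, r ≠ 0 ∧ r • x ∈ L := by
  have hx : x ∈ Submodule.span R (Set.range v) := hv ▸ Submodule.mem_top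
  induction hx using Submodule.span_induction with
  | mem x hx => obtain ⟨i, rfl⟩ := hx; exact h i
  | zero => exact ⟨1, one_ne_zero, by simp⟩
  | add x y _ _ hx hy =>
    obtain ⟨r, hr, hx⟩ := hx
    obtain ⟨q, hq, hy⟩ := hy
    refine ⟨r * q, mul_ne_zero hr hq, ?_⟩
    rw [smul_add]
    refine L.add_mem ?_ ?_
    · rw [mul_comm, mul_smul]; exact L.smul_mem _ hx
    · rw [mul_smul]; exact L.smul_mem _ hy
  | smul a x _ hx =>
    obtain ⟨r, hr, hx⟩ := hx
    refine ⟨r, hr, ?_⟩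
    rw [smul_comm]; exact L.smul_mem _ hx

theorem rank_of_indep_torsion {R M ι : Type*} [CommRing R] [IsDomain R] [AddCommGroup M]
    [Module R M] [Fintype ι] (v : ι → M) (S : Set ι)
    (hv : Submodule.span R (Set.range v) = ⊤) (hS : LinearIndepOn R v S)
    (h : ∀ i, ∃ r : R, r ≠ 0 ∧ r • v i ∈ Submodule.span R (v '' S)) :
    Module.rank R M = (Nat.card S : Cardinal) := by
  rw [← rank_eq_of_torsion _ (torsion_of_gen _ v hv h), Set.image_eq_range, rank_span hS]
  rw [← Nat.cast_card]
  congr 1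
  exact Nat.card_range_of_injective hS.injective

/-- Auxiliary abstract filtered data. -/
structure FD (Z A B N : Type*) [CommRing Z] [AddCommGroup A] [Module Z A] [CommRing B]
    [AddCommGroup N] [Module B N] where
  G : ℤ → AddSubgroup Z
  F : ℤ → AddSubgroup A
  s : ℤ → Z → B
  t : ℤ → A → N
  Gmono : Monotone G
  Gexh : ∀ z, ∃ i, z ∈ G i
  Fexh : ∀ a, ∃ i, a ∈ F i
  n₀ : ℤ
  hG : ∀ i ≤ n₀, ∀ z ∈ G i, z = 0
  hF : ∀ i ≤ n₀, ∀ a ∈ F i, a = 0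
  one_mem : 1 ∈ G 0
  s_one : s 0 1 = 1
  mul_mem : ∀ {i j z w}, z ∈ G i → w ∈ G j → z * w ∈ G (i + j)
  s_mul : ∀ {i j z w}, z ∈ G i → w ∈ G j → s (i + j) (z * w) = s i z * s j w
  smul_mem : ∀ {i j z a}, z ∈ G i → a ∈ F j → z • a ∈ F (i + j)
  t_smul : ∀ {i j z a}, z ∈ G i → a ∈ F j → t (i + j) (z • a) = s i z • t j a
  s_zero : ∀ {i z}, z ∈ G i → (s i z = 0 ↔ z ∈ G (i - 1))
  t_zero : ∀ {i a}, a ∈ F i → (t i a = 0 ↔ a ∈ F (i - 1))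
  t_add : ∀ {i a b}, a ∈ F i → b ∈ F i → t i (a + b) = t i a + t i b
  pB : ℤ → B →+ B
  pN : ℤ → N →+ N
  pB_mem : ∀ i b, ∃ z ∈ G i, s i z = pB i b
  pN_mem : ∀ i n, ∃ a ∈ F i, t i a = pN i n
  pN_t : ∀ {i a}, a ∈ F i → pN i (t i a) = t i a
  pN_smul : ∀ {d a}, a ∈ F d → ∀ i b, pN i (b • t d a) = pB (i - d) b • t d a
  pB_ne : ∀ b, b ≠ 0 → ∃ e, pB e b ≠ 0
  pN_sum : ∀ n, n ∈ Submodule.span B (Set.range fun i => pN i n)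

namespace FD

variable {Z A B N : Type*} [CommRing Z] [AddCommGroup A] [Module Z A] [CommRing B]
    [AddCommGroup N] [Module B N] (D : FD Z A B N)

theorem t_sum {ι : Type*} (T : Finset ι) (i : ℤ) (f : ι → A) (hf : ∀ p ∈ T, f p ∈ D.F i) :
    D.t i (∑ p ∈ T, f p) = ∑ p ∈ T, D.t i (f p) := by
  classical
  induction T using Finset.induction_on with
  | empty =>
    simp only [Finset.sum_empty]
    exact (D.t_zero (D.F i).zero_mem).2 (D.F _).zero_mem
  | insert p T hp ih =>
    rw [Finset.sum_insert hp, Finset.sum_insert hp, D.t_add, ih]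
    · intro q hq; exact hf q (Finset.mem_insert_of_mem hq)
    · exact hf p (Finset.mem_insert_self _ _)
    · exact (D.F i).sum_mem fun q hq => hf q (Finset.mem_insert_of_mem hq)

theorem t_sub {i : ℤ} {a b : A} (ha : a ∈ D.F i) (hb : b ∈ D.F i) :
    D.t i (a - b) = D.t i a - D.t i b := by
  rw [eq_sub_iff_add_eq, ← D.t_add ((D.F i).sub_mem ha hb) hb, sub_add_cancel]

theorem smul_mem' {i j k : ℤ} {z : Z} {a : A} (hz : z ∈ D.G i) (ha : a ∈ D.F j) (h : i + j = k) :
    z • a ∈ D.F k := h ▸ D.smul_mem hz ha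

theorem t_smul' {i j k : ℤ} {z : Z} {a : A} (hz : z ∈ D.G i) (ha : a ∈ D.F j) (h : i + j = k) :
    D.t k (z • a) = D.s i z • D.t j a := h ▸ D.t_smul hz ha

theorem mul_mem' {i j k : ℤ} {z w : Z} (hz : z ∈ D.G i) (hw : w ∈ D.G j) (h : i + j = k) :
    z * w ∈ D.G k := h ▸ D.mul_mem hz hw

/-- Descent: a vector whose filtration degree can always be lowered is zero. -/
theorem descent {ι : Type*} [Fintype ι] (d : ι → ℤ) (v : ι → Z)
    (h : ∀ i, (∀ p, v p ∈ D.G (i + d p)) → ∀ p, v p ∈ D.G (i + d p - 1)) : v = 0 := by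
  choose e he using fun p => D.Gexh (v p)
  obtain ⟨i, hi⟩ : ∃ i, ∀ p, v p ∈ D.G (i + d p) := by
    obtain ⟨M, hM⟩ := (Set.finite_range fun p => e p - d p).bddAbove
    refine ⟨M, fun p => D.Gmono ?_ (he p)⟩
    have := hM ⟨p, rfl⟩
    simp only at this
    lia
  have key : ∀ n : ℕ, ∀ p, v p ∈ D.G (i - n + d p) := by
    intro n
    induction n with
    | zero => simpa using hi
    | succ n ih =>
      intro p
      have := h _ ih p
      convert this using 2
      push_cast; ring
  funext p
  refine D.hG (min D.n₀ (i + d p)) (min_le_left _ _) _ ?_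
  have := key (i + d p - min D.n₀ (i + d p)).toNat p
  rw [Int.toNat_of_nonneg (by simp)] at this
  convert this using 2
  ring

theorem isDomain (D : FD Z A B N) [IsDomain B] : IsDomain Z := by
  have h0 : (1 : Z) ≠ 0 := by
    intro h
    have h1 := (D.s_zero D.one_mem).2 (by rw [h]; exact zero_mem _)
    rw [D.s_one] at h1
    exact one_ne_zero h1
  haveI : Nontrivial Z := ⟨1, 0, h0⟩
  have lead : ∀ z : Z, z ≠ 0 → ∃ i, z ∈ D.G i ∧ D.s i z ≠ 0 := by
    intro z hz
    by_contra! hc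
    have := D.descent (fun _ : Unit => 0) (fun _ => z) (fun i hi p =>
      (D.s_zero (hi p)).1 (hc _ (hi p)))
    exact hz (congrFun this ())
  haveI : NoZeroDivisors Z := by
    constructor
    intro z w hzw
    by_contra! hc
    obtain ⟨i, hi, hi'⟩ := lead z hc.1
    obtain ⟨j, hj, hj'⟩ := lead w hc.2
    have := D.s_mul hi hj
    rw [hzw, (D.s_zero (zero_mem _)).2 (zero_mem _)] at this
    exact mul_ne_zero hi' hj' this.symm
  exact NoZeroDivisors.to_isDomain Z

theorem exists_gens [Module.Finite B N] : ∃ (m : ℕ) (d : Fin m → ℤ) (a : Fin m → A),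
    (∀ p, a p ∈ D.F (d p)) ∧ Submodule.span B (Set.range fun p => D.t (d p) (a p)) = ⊤ := by
  let H : Set N := {x | ∃ i, ∃ a ∈ D.F i, D.t i a = x}
  have hH : Submodule.span B H = ⊤ := by
    rw [eq_top_iff]
    intro n _
    refine Submodule.span_mono ?_ (D.pN_sum n)
    rintro _ ⟨i, rfl⟩
    obtain ⟨a, ha, h⟩ := D.pN_mem i n
    exact ⟨i, a, ha, h⟩
  obtain ⟨T, hT, hT'⟩ := (Submodule.fg_span_iff_fg_span_finset_subset H).1
    (hH ▸ Module.Finite.fg_top)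
  have : ∀ x : T, ∃ i, ∃ a ∈ D.F i, D.t i a = x := fun x => hT x.2
  choose d a ha hta using this
  refine ⟨T.card, d ∘ T.equivFin.symm, a ∘ T.equivFin.symm, fun p => ha _, ?_⟩
  rw [← hH, hT']
  congr 1
  ext x
  simp only [Function.comp, hta, Set.mem_range, SetLike.mem_coe]
  constructor
  · rintro ⟨p, rfl⟩; exact (T.equivFin.symm p).2
  · intro hx; exact ⟨T.equivFin ⟨x, hx⟩, by simp⟩

/-- Filtered generation. -/
theorem gen {m : ℕ} {d : Fin m → ℤ} {a : Fin m → A} (ha : ∀ p, a p ∈ D.F (d p))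
    (hs : Submodule.span B (Set.range fun p => D.t (d p) (a p)) = ⊤) (i : ℤ) (x : A)
    (hx : x ∈ D.F i) : ∃ w : Fin m → Z, (∀ p, w p ∈ D.G (i - d p)) ∧ x = ∑ p, w p • a p := by
  have key : ∀ n : ℕ, ∀ i : ℤ, i ≤ D.n₀ + n → ∀ x ∈ D.F i,
      ∃ w : Fin m → Z, (∀ p, w p ∈ D.G (i - d p)) ∧ x = ∑ p, w p • a p := by
    intro n
    induction n with
    | zero =>
      intro i hi x hx
      exact ⟨0, fun p => zero_mem _, by simpa using D.hF i (by simpa using hi) x hx⟩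
    | succ n ih =>
      intro i hi x hx
      have h1 : D.t i x ∈ Submodule.span B (Set.range fun p => D.t (d p) (a p)) :=
        hs ▸ Submodule.mem_top
      obtain ⟨c, hc⟩ := (Submodule.mem_span_range_iff_exists_fun B).1 h1
      have h2 := congrArg (D.pN i) hc
      rw [D.pN_t hx, map_sum] at h2
      simp only [D.pN_smul (ha _)] at h2
      choose z hz hz' using fun p => D.pB_mem (i - d p) (c p)
      have hm : ∀ p, z p • a p ∈ D.F i := fun p => D.smul_mem' (hz p) (ha p) (by ring)
      have hm' : ∑ p, z p • a p ∈ D.F i := (D.F i).sum_mem fun p _ => hm p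
      have h3 : D.t i (x - ∑ p, z p • a p) = 0 := by
        rw [D.t_sub hx hm', D.t_sum _ _ _ (fun p _ => hm p), ← h2, sub_eq_zero]
        refine Finset.sum_congr rfl fun p _ => ?_
        rw [D.t_smul' (hz p) (ha p) (by ring), hz']
      obtain ⟨w, hw, hw'⟩ := ih (i - 1) (by push_cast at hi; lia) _
        ((D.t_zero ((D.F i).sub_mem hx hm')).1 h3)
      refine ⟨w + z, fun p => (D.G _).add_mem (D.Gmono (by lia) (hw p)) (hz p), ?_⟩
      simp only [Pi.add_apply, add_smul, Finset.sum_add_distrib, ← hw']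
      abel
  exact key (i - D.n₀).toNat i (by lia) x hx

theorem indep {ι : Type*} [Fintype ι] {d : ι → ℤ} {a : ι → A} (ha : ∀ p, a p ∈ D.F (d p))
    (hl : LinearIndependent B (fun p => D.t (d p) (a p))) : LinearIndependent Z a := by
  rw [Fintype.linearIndependent_iff]
  intro g hg
  have := D.descent (fun p => - d p) g (fun i hi => by
    have hm : ∀ p, g p • a p ∈ D.F i := fun p => D.smul_mem' (hi p) (ha p) (by ring)
    have h1 : D.t i (∑ p, g p • a p) = 0 := by
      rw [hg]; exact (D.t_zero (zero_mem _)).2 (zero_mem _)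
    rw [D.t_sum _ _ _ (fun p _ => hm p)] at h1
    have h2 : ∑ p, D.s (i + - d p) (g p) • D.t (d p) (a p) = 0 := by
      rw [← h1]
      exact Finset.sum_congr rfl fun p _ => (D.t_smul' (hi p) (ha p) (by ring)).symm
    exact fun p => (D.s_zero (hi p)).1 (Fintype.linearIndependent_iff.1 hl _ h2 p))
  exact fun p => congrFun this p

theorem main (D : FD Z A B N) [IsDomain B] [Module.Finite B N] :
    IsDomain Z ∧ Module.Finite Z A ∧ ∀ r : ℕ, Module.rank B N = r → Module.rank Z A = r := by
  classical
  haveI := D.isDomain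
  obtain ⟨m, d, a, ha, hs⟩ := D.exists_gens
  have hsA : Submodule.span Z (Set.range a) = ⊤ := by
    rw [eq_top_iff]
    intro x _
    obtain ⟨i, hi⟩ := D.Fexh x
    obtain ⟨w, -, rfl⟩ := D.gen ha hs i x hi
    exact (Submodule.mem_span_range_iff_exists_fun Z).2 ⟨w, rfl⟩
  refine ⟨‹_›, ⟨⟨Finset.univ.image a, by simpa using hsA⟩⟩, fun r hr => ?_⟩
  obtain ⟨S, hS, hS'⟩ := exists_maximal_linearIndepOn B (fun p => D.t (d p) (a p))
  have hN := rank_of_indep_torsion _ S hs hS (fun i => by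
    by_cases hi : i ∈ S
    · exact ⟨1, one_ne_zero, by
        rw [one_smul]; exact Submodule.subset_span ⟨i, hi, rfl⟩⟩
    · exact hS' i hi)
  obtain rfl : r = Nat.card S := by exact_mod_cast hr.symm.trans hN
  have hSA : LinearIndepOn Z a S := D.indep (d := fun p : S => d p) (fun p => ha p) hS
  refine rank_of_indep_torsion a S hsA hSA ?_
  set L := Submodule.span Z (a '' S) with hL
  have rows : ∀ l, ∃ (e : ℤ) (z : Z) (w : Fin m → Z), z ∈ D.G e ∧ D.s e z ≠ 0 ∧
      (∀ p, w p ∈ D.G (e - 1 + d l - d p)) ∧ z • a l - ∑ p, w p • a p ∈ L := by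
    intro l
    by_cases hl : l ∈ S
    · refine ⟨0, 1, 0, D.one_mem, by rw [D.s_one]; exact one_ne_zero, fun p => zero_mem _, ?_⟩
      have : a l ∈ L := Submodule.subset_span ⟨l, hl, rfl⟩
      simpa using this
    obtain ⟨b, hb, hbl⟩ := hS' l hl
    rw [Set.image_eq_range] at hbl
    obtain ⟨c, hc⟩ := (Submodule.mem_span_range_iff_exists_fun B).1 hbl
    obtain ⟨e, he⟩ := D.pB_ne b hb
    obtain ⟨z, hz, hz'⟩ := D.pB_mem e b
    have h2 := congrArg (D.pN (e + d l)) hc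
    rw [map_sum] at h2
    simp only [D.pN_smul (ha _), add_sub_cancel_right] at h2
    choose y hy hy' using fun p : S => D.pB_mem (e + d l - d p) (c p)
    have hm : ∀ p : S, y p • a p ∈ D.F (e + d l) :=
      fun p => D.smul_mem' (hy p) (ha p) (by ring)
    have hm' : ∑ p, y p • a p ∈ D.F (e + d l) := (D.F _).sum_mem fun p _ => hm p
    have hza : z • a l ∈ D.F (e + d l) := D.smul_mem hz (ha l)
    have h3 : D.t (e + d l) (z • a l - ∑ p, y p • a p) = 0 := by
      rw [D.t_sub hza hm', D.t_sum _ _ _ (fun p _ => hm p), D.t_smul hz (ha l), hz', ← h2,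
        sub_eq_zero]
      refine Finset.sum_congr rfl fun p _ => ?_
      rw [D.t_smul' (hy p) (ha p) (by ring), hy']
    obtain ⟨w, hw, hw'⟩ := D.gen ha hs _ _ ((D.t_zero ((D.F _).sub_mem hza hm')).1 h3)
    refine ⟨e, z, w, hz, hz' ▸ he, fun p => ?_, ?_⟩
    · convert hw p using 2; ring
    · rw [← hw', sub_sub_cancel]
      exact L.sum_mem fun p _ => L.smul_mem _ (Submodule.subset_span ⟨p, p.2, rfl⟩)
  choose e z w hz hz' hw hrow using rows
  let M : Matrix (Fin m) (Fin m) Z := Matrix.diagonal z - Matrix.of w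
  have hdet : M.det ≠ 0 := by
    intro h0
    obtain ⟨v, hv, hMv⟩ := Matrix.exists_mulVec_eq_zero_iff.2 h0
    apply hv
    refine D.descent d v fun i hi l => ?_
    have h1 : z l * v l = ∑ p, w l p * v p := by
      have := congrFun hMv l
      simp only [M, Matrix.sub_mulVec, Pi.sub_apply, Matrix.mulVec_diagonal, Pi.zero_apply,
        sub_eq_zero] at this
      exact this
    have h2 : z l * v l ∈ D.G (e l + (i + d l) - 1) := by
      rw [h1]
      exact (D.G _).sum_mem fun p _ => D.mul_mem' (hw l p) (hi p) (by ring)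
    rw [← D.s_zero (D.mul_mem (hz l) (hi l)), D.s_mul (hz l) (hi l)] at h2
    exact (D.s_zero (hi l)).1 ((mul_eq_zero.1 h2).resolve_left (hz' l))
  have hML : ∀ l, ∑ p, M l p • a p ∈ L := by
    intro l
    convert hrow l using 1
    simp [M, sub_smul, Finset.sum_sub_distrib, Matrix.diagonal_apply, ite_smul]
  intro q
  refine ⟨M.det, hdet, ?_⟩
  have h1 : M.det • a q = ∑ l, M.adjugate q l • ∑ p, M l p • a p := by
    simp only [Finset.smul_sum, smul_smul]
    rw [Finset.sum_comm]
    simp only [← Finset.sum_smul, ← Matrix.mul_apply, Matrix.adjugate_mul]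
    simp [Matrix.one_apply, ite_smul]
  rw [h1]
  exact L.sum_mem fun l _ => L.smul_mem _ (hML l)

end FD

/-- (1) If `M ⊆ M'` are finitely generated modules over an integral domain `R` with
`M'/M` torsion, then `M` and `M'` have the same rank
(`rank M = dim_{Frac R} (Frac R ⊗_R M)`).

(2) Filtered version: let `𝒜` be a filtered algebra over a field `𝕜` (exhaustive,
discrete filtration, multiplicative, `1 ∈ 𝒜_0`), `𝒵 ⊆ 𝒜` a central subalgebra with the
subspace filtration.  Suppose the associated graded objects are presented as follows: a
graded commutative domain `B` (= `gr 𝒵`) via surjective symbol maps `σ_i` on the pieces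
of the filtration of `𝒵` (with kernels the lower filtered pieces, multiplicative and
unital), and a graded `B`-module `Nmod` (= `gr 𝒜`) via symbol maps `τ_i` compatible with
the `𝒵`-action; if `Nmod` is a finitely generated `B`-module of rank `r`, then `𝒵` is an
integral domain and `𝒜` is a finitely generated `𝒵`-module of rank `r`. -/
theorem stmt14 {𝕜 : Type u} [Field 𝕜] :
    (∀ (R M' : Type v) [CommRing R] [IsDomain R] [AddCommGroup M'] [Module R M']
        (M : Submodule R M'),
        Module.Finite R M → Module.Finite R M' →
        (∀ x : M', ∃ r : R, r ≠ 0 ∧ r • x ∈ M) →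
        Module.finrank (FractionRing R) ((FractionRing R) ⊗[R] M) =
          Module.finrank (FractionRing R) ((FractionRing R) ⊗[R] M')) ∧
    (∀ (A : Type v) [Ring A] [Algebra 𝕜 A]
        (Z : Subalgebra 𝕜 A), (∀ z ∈ Z, ∀ a : A, z * a = a * z) →
      ∀ (FA : ℤ → Submodule 𝕜 A), Monotone FA → (⨆ i, FA i) = ⊤ →
        (∃ n₀ : ℤ, ∀ i ≤ n₀, FA i = ⊥) →
        (1 : A) ∈ FA 0 → (∀ i j : ℤ, FA i * FA j ≤ FA (i + j)) →
      ∀ (B : Type v) [CommRing B] [IsDomain B] [Algebra 𝕜 B]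
        (𝒷 : ℤ → Submodule 𝕜 B)
        (σ : ∀ i : ℤ, ((FA i).comap Z.val.toLinearMap) →ₗ[𝕜] B),
        (∀ i, LinearMap.range (σ i) = 𝒷 i) →
        (∀ (i : ℤ) (z : ((FA i).comap Z.val.toLinearMap)),
          σ i z = 0 ↔ ((z : Z) : A) ∈ FA (i - 1)) →
        (∀ (i j : ℤ) (z : ((FA i).comap Z.val.toLinearMap))
            (w : ((FA j).comap Z.val.toLinearMap))
            (hzw : ((z : Z) * (w : Z) : Z) ∈ (FA (i + j)).comap Z.val.toLinearMap),
          σ (i + j) ⟨(z : Z) * (w : Z), hzw⟩ = σ i z * σ j w) →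
        (∀ h1 : (1 : Z) ∈ (FA 0).comap Z.val.toLinearMap, σ 0 ⟨1, h1⟩ = 1) →
        DirectSum.IsInternal 𝒷 →
      ∀ (Nmod : Type v) [AddCommGroup Nmod] [Module 𝕜 Nmod] [Module B Nmod]
        [IsScalarTower 𝕜 B Nmod]
        (𝓃 : ℤ → Submodule 𝕜 Nmod)
        (τ : ∀ i : ℤ, (FA i) →ₗ[𝕜] Nmod),
        (∀ i, LinearMap.range (τ i) = 𝓃 i) →
        (∀ (i : ℤ) (a : FA i), τ i a = 0 ↔ (a : A) ∈ FA (i - 1)) →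
        (∀ (i j : ℤ) (z : ((FA i).comap Z.val.toLinearMap)) (a : FA j)
            (hza : ((z : Z) : A) * (a : A) ∈ FA (i + j)),
          τ (i + j) ⟨((z : Z) : A) * (a : A), hza⟩ = σ i z • τ j a) →
        DirectSum.IsInternal 𝓃 →
        Module.Finite B Nmod →
      ∀ r : ℕ, Module.rank B Nmod = r →
        letI : Module Z A := Module.compHom A (Z.val.toRingHom)
        IsDomain Z ∧ Module.Finite Z A ∧ Module.rank Z A = r) := by
  refine ⟨?_, ?_⟩
  · intro R M' _ _ _ _ M _ _ h
    have h1 := rank_eq_of_torsion M h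
    have e : ∀ (X : Type v) [AddCommGroup X] [Module R X],
        Module.rank (FractionRing R) ((FractionRing R) ⊗[R] X) = Module.rank R X := by
      intro X _ _
      have := IsLocalizedModule.rank_eq (nonZeroDivisors R) (f := TensorProduct.mk R (FractionRing R) X 1) le_rfl
      rw [← this]
      exact (IsLocalization.rank_eq (FractionRing R) (nonZeroDivisors R) le_rfl)
    rw [Module.finrank, Module.finrank, e, e, h1]
  · intro A _ _ Z hZ FA hmono hexh hdisc h1 hmul B _ _ _ 𝒷 σ hσr hσ0 hσm hσ1 hB Nmod _ _ _ _ 𝓃 τ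
      hτr hτ0 hτm hN hfin r hr
    classical
    letI : CommRing Z := { (inferInstance : Ring Z) with
      mul_comm := fun z w => Subtype.ext (hZ z z.2 w) }
    letI : Module Z A := Module.compHom A (Z.val.toRingHom)
    have hsm : ∀ (z : Z) (a : A), z • a = (z : A) * a := fun _ _ => rfl
    obtain ⟨n₀, hn₀⟩ := hdisc
    have hex : ∀ a : A, ∃ i, a ∈ FA i := fun a =>
      (Submodule.mem_iSup_of_directed _ hmono.directed_le).1 (hexh ▸ Submodule.mem_top)
    letI dB : DirectSum.Decomposition 𝒷 := hB.chooseDecomposition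
    letI dN : DirectSum.Decomposition 𝓃 := hN.chooseDecomposition
    have hmulA : ∀ {i j : ℤ} {x y : A}, x ∈ FA i → y ∈ FA j → x * y ∈ FA (i + j) :=
      fun hx hy => hmul _ _ (Submodule.mul_mem_mul hx hy)
    have hact : ∀ {i j : ℤ} {b : B} {n : Nmod}, b ∈ 𝒷 i → n ∈ 𝓃 j → b • n ∈ 𝓃 (i + j) := by
      intro i j b n hb hn
      rw [← hσr] at hb
      rw [← hτr] at hn ⊢
      obtain ⟨z, rfl⟩ := hb
      obtain ⟨a, rfl⟩ := hn
      exact ⟨_, hτm i j z a (hmulA z.2 a.2)⟩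
    have hsmulN : ∀ {d : ℤ} {n : Nmod}, n ∈ 𝓃 d → ∀ (i : ℤ) (b : B),
        (DirectSum.decompose 𝓃 (b • n) i : Nmod) = (DirectSum.decompose 𝒷 b (i - d) : B) • n := by
      intro d n hn i b
      induction b using DirectSum.Decomposition.inductionOn 𝒷 with
      | zero => simp
      | @homogeneous j b =>
        by_cases hij : j + d = i
        · subst hij
          rw [DirectSum.decompose_of_mem_same _ (hact b.2 hn), add_sub_cancel_right,
            DirectSum.decompose_of_mem_same _ b.2]
        · rw [DirectSum.decompose_of_mem_ne _ (hact b.2 hn) hij,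
            DirectSum.decompose_of_mem_ne _ b.2 (by lia), zero_smul]
      | add b c hb hc =>
        simp only [add_smul, DirectSum.decompose_add, DirectSum.add_apply, Submodule.coe_add, hb, hc]
    have hτmem : ∀ {i : ℤ} (a : FA i), τ i a ∈ 𝓃 i := fun {i} a => hτr i ▸ ⟨a, rfl⟩
    let D : FD Z A B Nmod :=
      { G := fun i => ((FA i).comap Z.val.toLinearMap).toAddSubgroup
        F := fun i => (FA i).toAddSubgroup
        s := fun i z => if h : z ∈ (FA i).comap Z.val.toLinearMap then σ i ⟨z, h⟩ else 0
        t := fun i a => if h : a ∈ FA i then τ i ⟨a, h⟩ else 0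
        Gmono := fun i j hij z hz => hmono hij hz
        Gexh := fun z => hex z
        Fexh := hex
        n₀ := n₀
        hG := fun i hi z hz => by
          have : (z : A) ∈ FA i := hz
          rw [hn₀ i hi] at this
          exact Subtype.ext this
        hF := fun i hi a ha => by
          have : a ∈ FA i := ha
          rw [hn₀ i hi] at this
          exact this
        one_mem := h1
        s_one := by
          have : (1 : Z) ∈ (FA 0).comap Z.val.toLinearMap := h1
          rw [dif_pos this]
          exact hσ1 _
        mul_mem := fun hz hw => hmulA hz hw
        s_mul := fun {i j z w} hz hw => by
          have hz' : z ∈ (FA i).comap Z.val.toLinearMap := hz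
          have hw' : w ∈ (FA j).comap Z.val.toLinearMap := hw
          have hzw : z * w ∈ (FA (i + j)).comap Z.val.toLinearMap := hmulA hz hw
          rw [dif_pos hz', dif_pos hw', dif_pos hzw]
          exact hσm i j ⟨z, hz'⟩ ⟨w, hw'⟩ hzw
        smul_mem := fun hz ha => hmulA hz ha
        t_smul := fun {i j z a} hz ha => by
          have hz' : z ∈ (FA i).comap Z.val.toLinearMap := hz
          have ha' : a ∈ FA j := ha
          have hza : z • a ∈ FA (i + j) := hmulA hz ha
          rw [dif_pos hz', dif_pos ha']
          refine (dif_pos hza).trans ?_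
          exact hτm i j ⟨z, hz'⟩ ⟨a, ha'⟩ hza
        s_zero := fun {i z} hz => by
          have hz' : z ∈ (FA i).comap Z.val.toLinearMap := hz
          rw [dif_pos hz']
          exact hσ0 i ⟨z, hz'⟩
        t_zero := fun {i a} ha => by
          have ha' : a ∈ FA i := ha
          rw [dif_pos ha']
          exact hτ0 i ⟨a, ha'⟩
        t_add := fun {i a b} ha hb => by
          have ha' : a ∈ FA i := ha
          have hb' : b ∈ FA i := hb
          rw [dif_pos ha', dif_pos hb', dif_pos ((FA i).add_mem ha' hb'), ← map_add]
          rfl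
        pB := fun i =>
          { toFun := fun b => (DirectSum.decompose 𝒷 b i : B)
            map_zero' := by simp
            map_add' := fun b c => by simp }
        pN := fun i =>
          { toFun := fun b => (DirectSum.decompose 𝓃 b i : Nmod)
            map_zero' := by simp
            map_add' := fun b c => by simp }
        pB_mem := fun i b => by
          have h : (DirectSum.decompose 𝒷 b i : B) ∈ LinearMap.range (σ i) :=
            (hσr i).symm ▸ (DirectSum.decompose 𝒷 b i).2
          obtain ⟨z, hz⟩ := h
          refine ⟨z, z.2, ?_⟩
          rw [dif_pos z.2]
          exact hz
        pN_mem := fun i b => by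
          have h : (DirectSum.decompose 𝓃 b i : Nmod) ∈ LinearMap.range (τ i) :=
            (hτr i).symm ▸ (DirectSum.decompose 𝓃 b i).2
          obtain ⟨z, hz⟩ := h
          refine ⟨z, z.2, ?_⟩
          rw [dif_pos z.2]
          exact hz
        pN_t := fun {i a} ha => by
          have ha' : a ∈ FA i := ha
          rw [dif_pos ha']
          exact DirectSum.decompose_of_mem_same _ (hτmem _)
        pN_smul := fun {d a} ha i b => by
          have ha' : a ∈ FA d := ha
          rw [dif_pos ha']
          exact hsmulN (hτmem _) i b
        pB_ne := fun b hb => by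
          by_contra! hc
          apply hb
          rw [← DirectSum.sum_support_decompose 𝒷 b]
          exact Finset.sum_eq_zero fun i _ => hc i
        pN_sum := fun n => by
          have h := DirectSum.sum_support_decompose 𝓃 n
          have h2 : (∑ i ∈ (DirectSum.decompose 𝓃 n).support, (DirectSum.decompose 𝓃 n i : Nmod)) ∈
            Submodule.span B (Set.range fun i => (DirectSum.decompose 𝓃 n i : Nmod)) :=
              Submodule.sum_mem _ fun i _ => Submodule.subset_span ⟨i, rfl⟩
          rw [h] at h2
          exact h2 }
    obtain ⟨p1, p2, p3⟩ := D.main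
    exact ⟨p1, p2, p3 r hr⟩
end
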